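/- Fix 0 < δ < 1/20. There exist constants 0 < a₃, A₃ < ∞ and σ₀ > 0 such that for all 0 < σ < σ₀ and every starting point x ∈ (−δ, 0), the canonical Markov chain {X_t} with transition kernel K̂_σ and X_0 = x satisfies P[∃ t < A₃·σ^{−a₃} with X_t ≤ −δ] ≥ 1 − e^{−σ^{−10}}. -/

import Mathlib

open MeasureTheory Filter Set

/-- Gaussian density `φ_σ` with mean 0 and variance `σ²`. -/
noncomputable def gaussDensity (σ x : ℝ) : ℝ :=
  (Real.sqrt (2 * Real.pi * σ ^ 2))⁻¹ * Real.exp (-(x ^ 2) / (2 * σ ^ 2))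

/-- Density `f_σ` of the mixture `½ N(-1,σ²) + ½ N(1,σ²)`. -/
noncomputable def mixDensity (σ x : ℝ) : ℝ :=
  (1 / 2) * gaussDensity σ (x + 1) + (1 / 2) * gaussDensity σ (x - 1)

/-- The `N(0,σ²)` measure, defined via its density `φ_σ` w.r.t. Lebesgue measure. -/
noncomputable def gaussMeasure (σ : ℝ) : Measure ℝ :=
  volume.withDensity fun z => ENNReal.ofReal (gaussDensity σ z)

/-- The random-walk Metropolis kernel `K_σ(x, ·)` as a measure: the accepted-move part
has density `min(1, f_σ(y)/f_σ(x))` w.r.t. the proposal `x + N(0,σ²)`, and the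
remaining mass `1 − ∫ min(1, f_σ(x+z)/f_σ(x)) φ_σ(z) dz` stays at `x`. -/
noncomputable def rwmKernel (σ : ℝ) (x : ℝ) : Measure ℝ :=
  ((gaussMeasure σ).map (fun z => x + z)).withDensity
      (fun y => ENNReal.ofReal (min 1 (mixDensity σ y / mixDensity σ x)))
  + (ENNReal.ofReal
      (1 - ∫ z, min 1 (mixDensity σ (x + z) / mixDensity σ x) * gaussDensity σ z))
      • Measure.dirac x

/-- The restricted Metropolis–Hastings kernel `K̂_σ` on `(-∞,0)`:
`K̂_σ(x,A) = K_σ(x, A ∩ (-∞,0)) + 1_A(x) K_σ(x,[0,∞))`. -/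
noncomputable def rwmKernelHat (σ : ℝ) (x : ℝ) : Measure ℝ :=
  (rwmKernel σ x).restrict (Set.Iio 0) + (rwmKernel σ x (Set.Ici 0)) • Measure.dirac x

/-- `P` is the law on trajectory space (as produced by the Ionescu–Tulcea construction)
of the Markov chain with transition kernel `κ` started at `x`: a probability measure
with `X 0 = x` a.s. such that, conditionally on the first `n+1` coordinates,
`X (n+1)` has law `κ (X n)`. -/
def IsMarkovChainLaw {α : Type*} [MeasurableSpace α] (κ : α → Measure α) (x : α)
    (P : Measure (ℕ → α)) : Prop :=
  IsProbabilityMeasure P ∧ P {ω | ω 0 = x} = 1 ∧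
  ∀ (n : ℕ) (A : Set (ℕ → α)),
    MeasurableSet[MeasurableSpace.comap (fun ω (i : Fin (n + 1)) => ω i.1) inferInstance] A →
    ∀ B : Set α, MeasurableSet B →
      P (A ∩ {ω | ω (n + 1) ∈ B}) = ∫⁻ ω in A, κ (ω n) B ∂P

lemma gaussDensity_eq_gaussianPDFReal (σ : ℝ) :
    gaussDensity σ = ProbabilityTheory.gaussianPDFReal 0 ⟨σ ^ 2, sq_nonneg σ⟩ := by
  ext x
  simp only [gaussDensity, ProbabilityTheory.gaussianPDFReal, sub_zero]
  rfl

lemma integrable_gaussDensity (σ : ℝ) : Integrable (gaussDensity σ) := by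
  rw [gaussDensity_eq_gaussianPDFReal]
  exact ProbabilityTheory.integrable_gaussianPDFReal _ _

lemma integral_gaussDensity {σ : ℝ} (hσ : 0 < σ) : ∫ z, gaussDensity σ z = 1 := by
  rw [gaussDensity_eq_gaussianPDFReal]
  refine ProbabilityTheory.integral_gaussianPDFReal_eq_one _ fun h => ?_
  exact (pow_pos hσ 2).ne' (congrArg NNReal.toReal h)

@[fun_prop]
lemma measurable_gaussDensity (σ : ℝ) : Measurable (gaussDensity σ) := by
  unfold gaussDensity
  fun_prop

@[fun_prop]
lemma measurable_mixDensity (σ : ℝ) : Measurable (mixDensity σ) := by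
  unfold mixDensity
  fun_prop

lemma gaussDensity_pos {σ : ℝ} (hσ : 0 < σ) (x : ℝ) : 0 < gaussDensity σ x := by
  unfold gaussDensity
  positivity

lemma mixDensity_pos {σ : ℝ} (hσ : 0 < σ) (x : ℝ) : 0 < mixDensity σ x := by
  have h₁ := gaussDensity_pos hσ (x + 1)
  have h₂ := gaussDensity_pos hσ (x - 1)
  unfold mixDensity
  positivity

lemma gaussDensity_le_zero {σ : ℝ} (hσ : 0 < σ) (z : ℝ) : gaussDensity σ z ≤ gaussDensity σ 0 := by
  unfold gaussDensity
  gcongr ?_ * Real.exp (?_ / ?_)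
  nlinarith [sq_nonneg z]

lemma half_gaussDensity_le_mixDensity {σ : ℝ} (hσ : 0 < σ) (x : ℝ) :
    1 / 2 * gaussDensity σ (x + 1) ≤ mixDensity σ x := by
  have := gaussDensity_pos hσ (x - 1)
  unfold mixDensity
  linarith

lemma mixDensity_le_gaussDensity {σ x : ℝ} (hx : x ≤ 0) :
    mixDensity σ x ≤ gaussDensity σ (x + 1) := by
  have : gaussDensity σ (x - 1) ≤ gaussDensity σ (x + 1) := by
    unfold gaussDensity
    gcongr ?_ * Real.exp (?_ / ?_)
    nlinarith
  unfold mixDensity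
  linarith

lemma gaussDensity_add {σ : ℝ} (hσ : 0 < σ) (m z : ℝ) :
    gaussDensity σ (m + z)
      = gaussDensity σ m * Real.exp (-(z * (2 * m + z)) / (2 * σ ^ 2)) := by
  unfold gaussDensity
  rw [mul_assoc _ (Real.exp _), ← Real.exp_add]
  congr 2
  field_simp
  ring

/-- Left of the origin the ratio `f_σ(x+z)/f_σ(x)` is within a factor `2` of the ratio for the
component centred at `-1`. -/
lemma mixDensity_ratio_le {σ x z : ℝ} (hσ : 0 < σ) (hxz : x + z ≤ 0) :
    mixDensity σ (x + z) / mixDensity σ x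
      ≤ 2 * Real.exp (-(z * (2 * (x + 1) + z)) / (2 * σ ^ 2)) := by
  have h₁ := half_gaussDensity_le_mixDensity hσ x
  have h₂ := mixDensity_le_gaussDensity (σ := σ) hxz
  rw [show x + z + 1 = x + 1 + z by ring, gaussDensity_add hσ] at h₂
  rw [div_le_iff₀ (mixDensity_pos hσ x)]
  nlinarith [Real.exp_pos (-(z * (2 * (x + 1) + z)) / (2 * σ ^ 2))]

lemma le_mixDensity_ratio {σ x z : ℝ} (hσ : 0 < σ) (hx : x ≤ 0) :
    1 / 2 * Real.exp (-(z * (2 * (x + 1) + z)) / (2 * σ ^ 2))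
      ≤ mixDensity σ (x + z) / mixDensity σ x := by
  have h₁ := half_gaussDensity_le_mixDensity hσ (x + z)
  have h₂ := mixDensity_le_gaussDensity (σ := σ) hx
  rw [show x + z + 1 = x + 1 + z by ring, gaussDensity_add hσ] at h₁
  rw [le_div_iff₀ (mixDensity_pos hσ x)]
  nlinarith [Real.exp_pos (-(z * (2 * (x + 1) + z)) / (2 * σ ^ 2))]

/-- Density of the accepted increments of the random-walk Metropolis chain at `x`. -/
noncomputable def acceptedDensity (σ x z : ℝ) : ℝ :=
  min 1 (mixDensity σ (x + z) / mixDensity σ x) * gaussDensity σ z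

lemma measurable_uncurry_acceptedDensity (σ : ℝ) :
    Measurable fun p : ℝ × ℝ => acceptedDensity σ p.1 p.2 := by
  unfold acceptedDensity
  fun_prop

@[fun_prop]
lemma measurable_acceptedDensity (σ x : ℝ) : Measurable (acceptedDensity σ x) := by
  unfold acceptedDensity
  fun_prop

lemma acceptedDensity_nonneg {σ : ℝ} (hσ : 0 < σ) (x z : ℝ) : 0 ≤ acceptedDensity σ x z := by
  have h₁ := mixDensity_pos hσ x
  have h₂ := mixDensity_pos hσ (x + z)
  have h₃ := gaussDensity_pos hσ z
  unfold acceptedDensity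
  positivity

lemma acceptedDensity_le {σ : ℝ} (hσ : 0 < σ) (x z : ℝ) :
    acceptedDensity σ x z ≤ gaussDensity σ z :=
  mul_le_of_le_one_left (gaussDensity_pos hσ z).le (min_le_left _ _)

lemma integrable_acceptedDensity {σ : ℝ} (hσ : 0 < σ) (x : ℝ) :
    Integrable (acceptedDensity σ x) := by
  refine (integrable_gaussDensity σ).mono' (by fun_prop) (.of_forall fun z => ?_)
  rw [Real.norm_of_nonneg (acceptedDensity_nonneg hσ x z)]
  exact acceptedDensity_le hσ x z

lemma integral_acceptedDensity_le_one {σ : ℝ} (hσ : 0 < σ) (x : ℝ) :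
    ∫ z, acceptedDensity σ x z ≤ 1 := by
  rw [← integral_gaussDensity hσ]
  exact integral_mono (integrable_acceptedDensity hσ x) (integrable_gaussDensity σ)
    (acceptedDensity_le hσ x)

lemma lintegral_rwmKernel {σ : ℝ} (hσ : 0 < σ) (x : ℝ) {h : ℝ → ENNReal} (hh : Measurable h) :
    ∫⁻ y, h y ∂rwmKernel σ x = (∫⁻ z, ENNReal.ofReal (acceptedDensity σ x z) * h (x + z))
      + ENNReal.ofReal (1 - ∫ z, acceptedDensity σ x z) * h x := by
  rw [rwmKernel, lintegral_add_measure, lintegral_smul_measure, lintegral_dirac' _ hh, smul_eq_mul,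
    lintegral_withDensity_eq_lintegral_mul _ (by fun_prop) hh, lintegral_map (by fun_prop)
    (by fun_prop), gaussMeasure, lintegral_withDensity_eq_lintegral_mul _ (by fun_prop)
    (by simp only [Pi.mul_apply]; fun_prop)]
  congr 1
  refine lintegral_congr fun z => ?_
  have h₁ := mixDensity_pos hσ x
  have h₂ := mixDensity_pos hσ (x + z)
  simp only [Pi.mul_apply, acceptedDensity]
  rw [ENNReal.ofReal_mul (by positivity)]
  ring

lemma measurable_rwmKernel {σ : ℝ} (hσ : 0 < σ) : Measurable (rwmKernel σ) := by
  refine Measure.measurable_of_measurable_coe _ fun B hB => ?_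
  have h₁ : Measurable (B.indicator (1 : ℝ → ENNReal)) := measurable_one.indicator hB
  simp_rw [← lintegral_indicator_one hB, lintegral_rwmKernel hσ _ h₁]
  refine .add ?_ (.mul (Measurable.ennreal_ofReal (measurable_const.sub ?_)) h₁)
  · exact Measurable.lintegral_prod_right' (f := fun p : ℝ × ℝ =>
      ENNReal.ofReal (acceptedDensity σ p.1 p.2) * B.indicator 1 (p.1 + p.2))
      ((measurable_uncurry_acceptedDensity σ).ennreal_ofReal.mul (h₁.comp (by fun_prop)))
  · exact (StronglyMeasurable.integral_prod_right (f := acceptedDensity σ)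
      (measurable_uncurry_acceptedDensity σ).stronglyMeasurable).measurable

lemma measurable_rwmKernelHat {σ : ℝ} (hσ : 0 < σ) : Measurable (rwmKernelHat σ) := by
  have hK := measurable_rwmKernel hσ
  refine Measure.measurable_of_measurable_coe _ fun B hB => ?_
  simp only [rwmKernelHat, Measure.add_apply, Measure.smul_apply, Measure.restrict_apply hB,
    Measure.dirac_apply' _ hB, smul_eq_mul]
  exact ((Measure.measurable_coe (hB.inter measurableSet_Iio)).comp hK).add
    (((Measure.measurable_coe measurableSet_Ici).comp hK).mul (measurable_one.indicator hB))

lemma rwmKernelHat_Ici {σ x : ℝ} (hx : x < 0) : rwmKernelHat σ x (Ici 0) = 0 := by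
  simp [rwmKernelHat, Measure.restrict_apply measurableSet_Ici, hx, Ici_inter_Iio]

lemma gaussDensity_zero_mul {σ : ℝ} (hσ : 0 < σ) : 1 / 3 ≤ gaussDensity σ 0 * σ := by
  have h : Real.sqrt (2 * Real.pi * σ ^ 2) ≤ 3 * σ :=
    Real.sqrt_le_iff.2 ⟨by positivity, by nlinarith [Real.pi_lt_d2, pow_pos hσ 2]⟩
  have h₀ : 0 < Real.sqrt (2 * Real.pi * σ ^ 2) := by positivity
  simp only [gaussDensity]
  norm_num
  rw [inv_mul_eq_div, le_div_iff₀ (by positivity)]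
  linarith

/-- Relative increment of `exp` along a proposed move `z` from `x`, moves to `[0, ∞)` being
rejected. -/
noncomputable def expIncrement (x z : ℝ) : ℝ :=
  if x + z < 0 then Real.exp z - 1 else 0

@[fun_prop]
lemma measurable_expIncrement (x : ℝ) : Measurable (expIncrement x) := by
  unfold expIncrement
  exact .ite (measurableSet_lt (by fun_prop) (by fun_prop)) (by fun_prop) (by fun_prop)

lemma neg_one_le_expIncrement (x z : ℝ) : -1 ≤ expIncrement x z := by
  unfold expIncrement
  split_ifs <;> linarith [Real.exp_pos z]

lemma exp_mul_one_add_expIncrement_le_one {x : ℝ} (hx : x < 0) (z : ℝ) :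
    Real.exp x * (1 + expIncrement x z) ≤ 1 := by
  unfold expIncrement
  split_ifs with h
  · rw [add_sub_cancel, ← Real.exp_add]
    exact Real.exp_le_one_iff.2 h.le
  · simpa using hx.le

lemma integrable_acceptedDensity_mul_expIncrement {σ x : ℝ} (hσ : 0 < σ) (hx : x < 0) :
    Integrable fun z => acceptedDensity σ x z * expIncrement x z := by
  refine (integrable_acceptedDensity hσ x).mul_bdd (c := Real.exp (-x) + 1) (by fun_prop)
    (.of_forall fun z => ?_)
  have h := exp_mul_one_add_expIncrement_le_one hx z
  rw [← le_div_iff₀' (Real.exp_pos x), one_div, ← Real.exp_neg] at h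
  rw [Real.norm_eq_abs, abs_le]
  constructor <;> linarith [neg_one_le_expIncrement x z, Real.exp_pos (-x)]

lemma lintegral_exp_rwmKernelHat {σ x : ℝ} (hσ : 0 < σ) (hx : x < 0) :
    ∫⁻ y, ENNReal.ofReal (Real.exp y) ∂rwmKernelHat σ x
      = ENNReal.ofReal
        (Real.exp x * (1 + ∫ z, acceptedDensity σ x z * expIncrement x z)) := by
  have hm : Measurable fun y => ENNReal.ofReal (Real.exp y) := by fun_prop
  have hI := integrable_acceptedDensity hσ x
  have hE := integrable_acceptedDensity_mul_expIncrement hσ hx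
  have hα : 0 ≤ 1 - ∫ z, acceptedDensity σ x z :=
    sub_nonneg.2 (integral_acceptedDensity_le_one hσ x)
  have hone : Measurable ((Ici (0 : ℝ)).indicator (1 : ℝ → ENNReal)) :=
    measurable_one.indicator measurableSet_Ici
  have hint : Integrable fun z =>
      acceptedDensity σ x z * (Real.exp x * (1 + expIncrement x z)) := by
    have : (fun z => acceptedDensity σ x z * (Real.exp x * (1 + expIncrement x z)))
        = fun z => Real.exp x *
          (acceptedDensity σ x z + acceptedDensity σ x z * expIncrement x z) := by
      ext z
      ring
    rw [this]
    exact (hI.add hE).const_mul _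
  have hnonneg (z : ℝ) : 0 ≤ Real.exp x * (1 + expIncrement x z) :=
    mul_nonneg (Real.exp_pos x).le (by linarith [neg_one_le_expIncrement x z])
  have hmove : ∫⁻ z, ENNReal.ofReal (acceptedDensity σ x z)
        * (Iio 0).indicator (fun y => ENNReal.ofReal (Real.exp y)) (x + z)
      + ENNReal.ofReal (acceptedDensity σ x z) * (Ici 0).indicator 1 (x + z)
        * ENNReal.ofReal (Real.exp x)
      = ENNReal.ofReal
        (∫ z, acceptedDensity σ x z * (Real.exp x * (1 + expIncrement x z))) := by
    rw [ofReal_integral_eq_lintegral_ofReal hint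
      (.of_forall fun z => mul_nonneg (acceptedDensity_nonneg hσ x z) (hnonneg z))]
    refine lintegral_congr fun z => ?_
    rw [ENNReal.ofReal_mul (acceptedDensity_nonneg hσ x z)]
    by_cases h : x + z < 0
    · simp [expIncrement, h, ← Real.exp_add]
    · simp [expIncrement, h, not_lt.1 h]
  have hcalc : ∫ z, acceptedDensity σ x z * (Real.exp x * (1 + expIncrement x z))
      = Real.exp x * (∫ z, acceptedDensity σ x z)
        + Real.exp x * ∫ z, acceptedDensity σ x z * expIncrement x z := by
    rw [← mul_add, ← integral_add hI hE, ← integral_const_mul]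
    congr 1 with z
    ring
  rw [rwmKernelHat, lintegral_add_measure, lintegral_smul_measure, lintegral_dirac' _ hm,
    ← lintegral_indicator measurableSet_Iio, ← lintegral_indicator_one measurableSet_Ici,
    lintegral_rwmKernel hσ _ (hm.indicator measurableSet_Iio), lintegral_rwmKernel hσ _ hone]
  rw [indicator_of_mem (mem_Iio.2 hx), indicator_of_notMem (by simpa using hx), mul_zero, add_zero,
    smul_eq_mul, ← lintegral_mul_const' _ _ ENNReal.ofReal_ne_top, add_right_comm,
    ← lintegral_add_left (by
      exact (by fun_prop : Measurable fun z => ENNReal.ofReal (acceptedDensity σ x z)).mul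
        ((hm.indicator measurableSet_Iio).comp (by fun_prop))), hmove,
    ← ENNReal.ofReal_mul hα, ← ENNReal.ofReal_add (integral_nonneg fun z =>
      mul_nonneg (acceptedDensity_nonneg hσ x z) (hnonneg z)) (by positivity), hcalc]
  congr 1
  ring

lemma acceptedDensity_mul_expIncrement_le {σ x : ℝ} (hσ : 0 < σ) (hσ' : σ < 1 / 1000)
    (hx : x ∈ Ioo (-(1 / 20)) (0 : ℝ)) (z : ℝ) :
    acceptedDensity σ x z * expIncrement x z
      ≤ (Ioi 0).indicator
          (fun z => 16 * σ ^ 2 * gaussDensity σ 0 * Real.exp (-(1 / (8 * σ ^ 2)) * z)) z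
        - (Icc (-2 * σ) (-σ)).indicator (fun _ => gaussDensity σ 0 * σ / 36) z := by
  obtain ⟨hx₁, hx₂⟩ := hx
  have hφ := gaussDensity_pos hσ 0
  have hr := acceptedDensity_nonneg hσ x z
  have hσ2 : 0 < σ ^ 2 := by positivity
  rcases lt_or_ge 0 z with hz | hz
  · rw [indicator_of_mem (mem_Ioi.2 hz), indicator_of_notMem (fun h => by linarith [h.2]), sub_zero]
    unfold expIncrement
    split_ifs with hxz
    · set c := 1 / (8 * σ ^ 2) with hc
      have hc₁ : 1 ≤ 2 * c := by
        rw [hc, mul_one_div, le_div_iff₀ (by positivity)]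
        nlinarith
      have hdens : acceptedDensity σ x z ≤ 2 * Real.exp (-(4 * c * z)) * gaussDensity σ 0 := by
        refine mul_le_mul ((min_le_right _ _).trans ((mixDensity_ratio_le hσ hxz.le).trans ?_))
          (gaussDensity_le_zero hσ z) (gaussDensity_pos hσ z).le (by positivity)
        gcongr
        rw [hc, div_le_iff₀ (by positivity)]
        field_simp
        nlinarith
      have hexp : Real.exp z - 1 ≤ z * Real.exp z := by
        have h := Real.add_one_le_exp (-z)
        have := mul_le_mul_of_nonneg_right h (Real.exp_pos z).le
        rw [← Real.exp_add, neg_add_cancel, Real.exp_zero] at this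
        linarith
      have hz' : z ≤ 8 * σ ^ 2 * Real.exp (c * z) := by
        have h : c * z ≤ Real.exp (c * z) := by linarith [Real.add_one_le_exp (c * z)]
        have : 8 * σ ^ 2 * (c * z) = z := by rw [hc]; field_simp
        nlinarith
      have hexp' : Real.exp z ≤ Real.exp (2 * c * z) := Real.exp_le_exp.2 (by nlinarith)
      calc acceptedDensity σ x z * (Real.exp z - 1)
          ≤ (2 * Real.exp (-(4 * c * z)) * gaussDensity σ 0)
            * ((8 * σ ^ 2 * Real.exp (c * z)) * Real.exp (2 * c * z)) := by
            refine mul_le_mul hdens (hexp.trans ?_) ?_ (by positivity)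
            · gcongr
            · linarith [Real.one_le_exp hz.le]
        _ = 16 * σ ^ 2 * gaussDensity σ 0
            * (Real.exp (-(4 * c * z)) * Real.exp (c * z) * Real.exp (2 * c * z)) := by ring
        _ = _ := by
            rw [← Real.exp_add, ← Real.exp_add]
            ring_nf
    · rw [mul_zero]
      positivity
  · rw [indicator_of_notMem (by simpa using hz), zero_sub, expIncrement, if_pos (by linarith)]
    have hexp : Real.exp z ≤ 1 := Real.exp_le_one_iff.2 hz
    by_cases hzI : z ∈ Icc (-2 * σ) (-σ)
    · rw [indicator_of_mem hzI]
      obtain ⟨hz₁, hz₂⟩ := hzI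
      have hratio : 1 / 2 ≤ mixDensity σ (x + z) / mixDensity σ x := by
        refine le_trans ?_ (le_mixDensity_ratio hσ hx₂.le)
        have : 1 ≤ Real.exp (-(z * (2 * (x + 1) + z)) / (2 * σ ^ 2)) := by
          refine Real.one_le_exp (div_nonneg ?_ (by positivity))
          nlinarith
        linarith
      have hgauss : gaussDensity σ 0 / 9 ≤ gaussDensity σ z := by
        have h := gaussDensity_add hσ 0 z
        rw [zero_add] at h
        have h₂ : Real.exp (-2) ≤ Real.exp (-(z * (2 * 0 + z)) / (2 * σ ^ 2)) := by
          refine Real.exp_le_exp.2 ?_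
          rw [le_div_iff₀ (by positivity)]
          nlinarith
        have h₃ : 1 / 9 ≤ Real.exp (-2) := by
          rw [Real.exp_neg, one_div]
          refine inv_anti₀ (Real.exp_pos _) ?_
          rw [show (2 : ℝ) = 1 + 1 by norm_num, Real.exp_add]
          nlinarith [Real.exp_one_lt_d9, Real.exp_pos 1]
        rw [h]
        nlinarith
      have hdens : gaussDensity σ 0 / 18 ≤ acceptedDensity σ x z := by
        unfold acceptedDensity
        nlinarith [le_min (by norm_num : (1 / 2 : ℝ) ≤ 1) hratio]
      have hgap : σ / 2 ≤ 1 - Real.exp z := by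
        have h := Real.add_one_le_exp (-z)
        have h' : Real.exp z * Real.exp (-z) = 1 := by rw [← Real.exp_add]; simp
        nlinarith [Real.exp_pos z]
      nlinarith
    · rw [indicator_of_notMem hzI, neg_zero]
      nlinarith

/-- Near the origin, the Metropolis chain restricted to the left half-line has a drift of order `σ`
to the left, as measured by `exp`. -/
lemma integral_acceptedDensity_mul_expIncrement_le {σ x : ℝ} (hσ : 0 < σ) (hσ' : σ < 1 / 1000)
    (hx : x ∈ Ioo (-(1 / 20)) (0 : ℝ)) :
    ∫ z, acceptedDensity σ x z * expIncrement x z ≤ -(σ / 216) := by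
  have hc : -(1 / (8 * σ ^ 2)) < 0 := by
    rw [neg_lt_zero]
    positivity
  have hint₁ : Integrable ((Ioi 0).indicator
      (fun z => 16 * σ ^ 2 * gaussDensity σ 0 * Real.exp (-(1 / (8 * σ ^ 2)) * z))) :=
    (integrable_indicator_iff measurableSet_Ioi).2 ((integrableOn_exp_mul_Ioi hc 0).const_mul _)
  have hint₂ : Integrable ((Icc (-2 * σ) (-σ)).indicator
      (fun _ => gaussDensity σ 0 * σ / 36)) :=
    (integrable_indicator_iff measurableSet_Icc).2 (integrableOn_const (by simp))
  refine (integral_mono (integrable_acceptedDensity_mul_expIncrement hσ hx.2) (hint₁.sub hint₂)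
    (acceptedDensity_mul_expIncrement_le hσ hσ' hx)).trans ?_
  rw [integral_sub' hint₁ hint₂, integral_indicator measurableSet_Ioi,
    integral_indicator measurableSet_Icc, integral_const_mul, integral_exp_mul_Ioi hc,
    setIntegral_const, Real.volume_real_Icc_of_le (by linarith)]
  have hφ := gaussDensity_zero_mul hσ
  have hsq : σ ^ 2 ≤ 1 / 1000000 := by nlinarith
  have heq : -Real.exp (-(1 / (8 * σ ^ 2)) * 0) / -(1 / (8 * σ ^ 2)) = 8 * σ ^ 2 := by
    rw [mul_zero, Real.exp_zero]
    field_simp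
  rw [heq, smul_eq_mul]
  have : 16 * σ ^ 2 * gaussDensity σ 0 * (8 * σ ^ 2) - (-σ - -2 * σ) * (gaussDensity σ 0 * σ / 36)
      = -(gaussDensity σ 0 * σ * (σ * (1 / 36 - 128 * σ ^ 2))) := by ring
  rw [this, neg_le_neg_iff]
  have h₂ : σ / 72 ≤ σ * (1 / 36 - 128 * σ ^ 2) := by nlinarith
  nlinarith

lemma lintegral_exp_rwmKernelHat_le {σ x : ℝ} (hσ : 0 < σ) (hσ' : σ < 1 / 1000)
    (hx : x ∈ Ioo (-(1 / 20)) (0 : ℝ)) :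
    ∫⁻ y, ENNReal.ofReal (Real.exp y) ∂rwmKernelHat σ x
      ≤ ENNReal.ofReal (1 - σ / 216) * ENNReal.ofReal (Real.exp x) := by
  rw [lintegral_exp_rwmKernelHat hσ hx.2, ← ENNReal.ofReal_mul (by linarith)]
  refine ENNReal.ofReal_le_ofReal ?_
  rw [mul_comm]
  gcongr
  linarith [integral_acceptedDensity_mul_expIncrement_le hσ hσ' hx]

namespace IsMarkovChainLaw

variable {α : Type*} [MeasurableSpace α] {κ : α → Measure α} {x : α} {P : Measure (ℕ → α)}

lemma ae_zero_eq [MeasurableSingletonClass α] (hP : IsMarkovChainLaw κ x P) :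
    ∀ᵐ ω ∂P, ω 0 = x := by
  have := hP.1
  have hm : MeasurableSet {ω : ℕ → α | ω 0 = x} :=
    (measurable_pi_apply (X := fun _ : ℕ => α) 0) (measurableSet_singleton x)
  exact (mem_ae_iff_prob_eq_one hm).2 hP.2.1

lemma setLIntegral_succ (hP : IsMarkovChainLaw κ x P) (hκ : Measurable κ) {n : ℕ}
    {A : Set (ℕ → α)}
    (hA : MeasurableSet[MeasurableSpace.comap (fun ω (i : Fin (n + 1)) => ω i.1) inferInstance] A)
    {g : α → ENNReal} (hg : Measurable g) :
    ∫⁻ ω in A, g (ω (n + 1)) ∂P = ∫⁻ ω in A, ∫⁻ y, g y ∂κ (ω n) ∂P := by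
  have hκn : Measurable fun ω : ℕ → α => κ (ω n) := hκ.comp (measurable_pi_apply n)
  have hmap : (P.restrict A).map (fun ω => ω (n + 1))
      = (P.restrict A).bind fun ω => κ (ω n) := by
    ext B hB
    rw [Measure.map_apply (measurable_pi_apply _) hB, Measure.bind_apply hB hκn.aemeasurable,
      Measure.restrict_apply (measurable_pi_apply _ hB), inter_comm]
    exact hP.2.2 n A hA B hB
  rw [← lintegral_map hg (measurable_pi_apply _), hmap,
    Measure.lintegral_bind hκn.aemeasurable hg.aemeasurable]

lemma measurableSet_forall_le {D : Set α} (hD : MeasurableSet D) (n : ℕ) :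
    MeasurableSet[MeasurableSpace.comap (fun (ω : ℕ → α) (i : Fin (n + 1)) => ω i.1) inferInstance]
      {ω : ℕ → α | ∀ i ≤ n, ω i ∈ D} := by
  refine ⟨{f | ∀ i, f i ∈ D}, ?_, ?_⟩
  · simp only [ofPred_forall]
    exact MeasurableSet.iInter fun i => measurable_pi_apply i hD
  · ext ω
    simp [Fin.forall_iff]

/-- Geometric decay of a Lyapunov function along the chain killed outside `D`. -/
lemma setLIntegral_le_pow_mul [MeasurableSingletonClass α] (hP : IsMarkovChainLaw κ x P)
    (hκ : Measurable κ) {D : Set α} (hD : MeasurableSet D) {g : α → ENNReal} (hg : Measurable g)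
    {ρ : ENNReal} (hρ : ∀ y ∈ D, ∫⁻ z, g z ∂κ y ≤ ρ * g y) (n : ℕ) :
    ∫⁻ ω in {ω | ∀ i ≤ n, ω i ∈ D}, g (ω n) ∂P ≤ ρ ^ n * g x := by
  have := hP.1
  induction n with
  | zero =>
    calc ∫⁻ ω in {ω | ∀ i ≤ 0, ω i ∈ D}, g (ω 0) ∂P ≤ ∫⁻ ω, g (ω 0) ∂P :=
          setLIntegral_le_lintegral _ _
      _ = ∫⁻ _, g x ∂P := lintegral_congr_ae (hP.ae_zero_eq.mono fun ω h => by simp only [h])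
      _ = ρ ^ 0 * g x := by simp
  | succ n ih =>
    have hmeas := measurableSet_forall_le hD n
    have hle : MeasurableSpace.comap (fun (ω : ℕ → α) (i : Fin (n + 1)) => ω i.1) inferInstance
        ≤ MeasurableSpace.pi :=
      Measurable.comap_le (measurable_pi_lambda _ fun i => measurable_pi_apply _)
    calc ∫⁻ ω in {ω | ∀ i ≤ n + 1, ω i ∈ D}, g (ω (n + 1)) ∂P
        ≤ ∫⁻ ω in {ω | ∀ i ≤ n, ω i ∈ D}, g (ω (n + 1)) ∂P :=
          lintegral_mono_set fun ω h i hi => h i (hi.trans n.le_succ)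
      _ = ∫⁻ ω in {ω | ∀ i ≤ n, ω i ∈ D}, ∫⁻ y, g y ∂κ (ω n) ∂P :=
          hP.setLIntegral_succ hκ hmeas hg
      _ ≤ ∫⁻ ω in {ω | ∀ i ≤ n, ω i ∈ D}, ρ * g (ω n) ∂P :=
          setLIntegral_mono' (hle _ hmeas) fun ω h => hρ _ (h n le_rfl)
      _ = ρ * ∫⁻ ω in {ω | ∀ i ≤ n, ω i ∈ D}, g (ω n) ∂P :=
          lintegral_const_mul _ (hg.comp (measurable_pi_apply n))
      _ ≤ ρ * (ρ ^ n * g x) := by gcongr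
      _ = ρ ^ (n + 1) * g x := by ring

/-- A chain started in a set `S` that its kernel never leaves stays in `S` forever, almost surely. -/
lemma ae_forall_mem [MeasurableSingletonClass α] (hP : IsMarkovChainLaw κ x P) {S : Set α}
    (hS : MeasurableSet S) (hx : x ∈ S) (hκS : ∀ y ∈ S, κ y Sᶜ = 0) : ∀ᵐ ω ∂P, ∀ n, ω n ∈ S := by
  refine ae_all_iff.2 fun n => ?_
  induction n with
  | zero =>
    exact hP.ae_zero_eq.mono fun ω h => h ▸ hx
  | succ n ih =>
    have h := hP.2.2 n univ .univ Sᶜ hS.compl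
    rw [univ_inter, setLIntegral_univ, lintegral_congr_ae (ih.mono fun ω hω => hκS _ hω),
      lintegral_zero] at h
    exact h

end IsMarkovChainLaw

lemma exp_mul_pow_le {σ δ : ℝ} (hσ : 0 < σ) (hσ' : σ < 1 / 1000) (hδ : δ < 1 / 20) {N : ℕ}
    (hN : σ ^ (-12 : ℝ) < N + 1) :
    Real.exp δ * (1 - σ / 216) ^ N ≤ Real.exp (-(1 / σ ^ 10)) := by
  have hpow : (1 - σ / 216) ^ N ≤ Real.exp (-(σ / 216) * N) := by
    rw [mul_comm, Real.exp_nat_mul]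
    gcongr
    · linarith
    · linarith [Real.add_one_le_exp (-(σ / 216))]
  calc Real.exp δ * (1 - σ / 216) ^ N ≤ Real.exp δ * Real.exp (-(σ / 216) * N) := by gcongr
    _ = Real.exp (δ + -(σ / 216) * N) := (Real.exp_add _ _).symm
    _ ≤ _ := by
      refine Real.exp_le_exp.2 ?_
      rw [Real.rpow_neg hσ.le, show (12 : ℝ) = ((12 : ℕ) : ℝ) by norm_num, Real.rpow_natCast] at hN
      have h₁ : σ * (σ ^ 12)⁻¹ = 1 / σ * (1 / σ ^ 10) := by field_simp
      have h₂ : 1000 ≤ 1 / σ := by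
        rw [le_div_iff₀ hσ]
        linarith
      have h₃ : 1 ≤ 1 / σ ^ 10 := by
        rw [le_div_iff₀ (by positivity), one_mul]
        exact pow_le_one₀ hσ.le (by linarith)
      nlinarith

/-- The chain with kernel `K̂_σ` started anywhere in `(-δ,0)` reaches `(-∞,-δ]` within
polynomially many (`A₃ σ^{-a₃}`) steps, except with probability at most `e^{-σ^{-10}}`. -/
theorem stmt14 (δ : ℝ) (hδ0 : 0 < δ) (hδ : δ < 1 / 20) :
    ∃ a A : ℝ, 0 < a ∧ 0 < A ∧ ∃ σ₀ : ℝ, 0 < σ₀ ∧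
      ∀ σ : ℝ, 0 < σ → σ < σ₀ →
        ∀ x ∈ Set.Ioo (-δ) (0 : ℝ), ∀ P : Measure (ℕ → ℝ),
          IsMarkovChainLaw (rwmKernelHat σ) x P →
            1 - Real.exp (-(1 / σ ^ 10))
              ≤ (P {ω | ∃ t : ℕ, (t : ℝ) < A * σ ^ (-a) ∧ ω t ≤ -δ}).toReal := by
  refine ⟨12, 2, by norm_num, by norm_num, 1 / 1000, by norm_num, fun σ hσ hσ' x hx P hP => ?_⟩
  have := hP.1
  set S : Set (ℕ → ℝ) := {ω | ∃ t : ℕ, (t : ℝ) < 2 * σ ^ (-12 : ℝ) ∧ ω t ≤ -δ}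
  set N := ⌊σ ^ (-12 : ℝ)⌋₊
  set E : Set (ℕ → ℝ) := {ω | ∀ i ≤ N, ω i ∈ Ioo (-δ) (0 : ℝ)}
  have hσN : 0 < σ ^ (-12 : ℝ) := Real.rpow_pos_of_pos hσ _
  have hNle : (N : ℝ) ≤ σ ^ (-12 : ℝ) := Nat.floor_le hσN.le
  have hκ := measurable_rwmKernelHat hσ
  have hneg : ∀ᵐ ω ∂P, ∀ n, ω n ∈ Iio (0 : ℝ) :=
    hP.ae_forall_mem measurableSet_Iio hx.2 fun y hy => by
      rw [compl_Iio]
      exact rwmKernelHat_Ici hy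
  have hSE : P Sᶜ ≤ P E := by
    refine measure_mono_ae (hneg.mono fun ω hω hS i hi => ⟨?_, hω i⟩)
    by_contra! h
    refine hS ⟨i, ?_, h⟩
    have : (i : ℝ) ≤ N := by exact_mod_cast hi
    linarith
  have hE : P E ≤ ENNReal.ofReal (Real.exp (-(1 / σ ^ 10))) := by
    have hlyap := hP.setLIntegral_le_pow_mul hκ (measurableSet_Ioo (a := -δ) (b := 0))
      (g := fun y => ENNReal.ofReal (Real.exp y)) (by fun_prop)
      (fun y hy => lintegral_exp_rwmKernelHat_le hσ hσ' ⟨by linarith [hy.1], hy.2⟩) N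
    have hlow : ENNReal.ofReal (Real.exp (-δ)) * P E
        ≤ ∫⁻ ω in E, ENNReal.ofReal (Real.exp (ω N)) ∂P := by
      rw [← setLIntegral_const]
      refine setLIntegral_mono (by fun_prop) fun ω hω => ?_
      gcongr
      exact (hω N le_rfl).1.le
    have hup : ENNReal.ofReal (Real.exp x) ≤ 1 := by
      rw [ENNReal.ofReal_le_one]
      exact Real.exp_le_one_iff.2 hx.2.le
    calc P E = ENNReal.ofReal (Real.exp δ) * (ENNReal.ofReal (Real.exp (-δ)) * P E) := by
          rw [← mul_assoc, ← ENNReal.ofReal_mul (Real.exp_pos _).le, ← Real.exp_add]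
          simp
      _ ≤ ENNReal.ofReal (Real.exp δ) * (ENNReal.ofReal (1 - σ / 216) ^ N * 1) := by
          refine mul_le_mul_right (hlow.trans (hlyap.trans ?_)) _
          gcongr
      _ = ENNReal.ofReal (Real.exp δ * (1 - σ / 216) ^ N) := by
          rw [mul_one, ← ENNReal.ofReal_pow (by linarith), ← ENNReal.ofReal_mul (Real.exp_pos _).le]
      _ ≤ _ := ENNReal.ofReal_le_ofReal
          (exp_mul_pow_le hσ hσ' hδ (Nat.lt_floor_add_one _))
  have hcover : 1 ≤ P.real S + P.real Sᶜ := by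
    rw [← probReal_univ (μ := P), ← union_compl_self S]
    exact measureReal_union_le _ _
  have hcompl : P.real Sᶜ ≤ Real.exp (-(1 / σ ^ 10)) :=
    ENNReal.toReal_le_of_le_ofReal (Real.exp_pos _).le (hSE.trans hE)
  change _ ≤ P.real S
  linarith
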